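/- For all natural numbers m, n with m ≥ 16 and n ≥ 16, the domination number of G_{m,n} satisfies γ(G_{m,n}) ≤ ⌊(m+2)(n+2)/5⌋ − 4. -/

import Mathlib

/-- The m×n grid graph on vertex set `Fin m × Fin n`:
`(i,j)` and `(i',j')` are adjacent iff `|i−i'| + |j−j'| = 1`. -/
def gridGraph (m n : ℕ) : SimpleGraph (Fin m × Fin n) :=
  SimpleGraph.fromRel fun u v =>
    (u.1 = v.1 ∧ (u.2 : ℕ) + 1 = (v.2 : ℕ)) ∨ (u.2 = v.2 ∧ (u.1 : ℕ) + 1 = (v.1 : ℕ))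

/-- A set `D` of vertices is dominating if every vertex not in `D`
is adjacent to some vertex of `D`. -/
def IsDominatingSet {V : Type*} (G : SimpleGraph V) (D : Set V) : Prop :=
  ∀ v ∉ D, ∃ u ∈ D, G.Adj u v

/-- The domination number: the minimum cardinality of a dominating set. -/
noncomputable def dominationNumber {V : Type*} [Fintype V] (G : SimpleGraph V) : ℕ :=
  sInf {k | ∃ D : Finset V, IsDominatingSet G ↑D ∧ D.card = k}

namespace GridDomination

/-- Two lattice points are equal or at distance one. -/
def Near (p q : ℤ × ℤ) : Prop :=
  (p.1 = q.1 ∧ (p.2 = q.2 ∨ p.2 + 1 = q.2 ∨ q.2 + 1 = p.2)) ∨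
    (p.2 = q.2 ∧ (p.1 + 1 = q.1 ∨ q.1 + 1 = p.1))

instance (p q : ℤ × ℤ) : Decidable (Near p q) := by unfold Near; infer_instance

/-- The residue whose classes are the perfect dominating sets of `ℤ × ℤ`. -/
def residue (p : ℤ × ℤ) : ℤ := (p.1 + 2 * p.2) % 5

/-- The points with coordinates between `a` and `b`. -/
noncomputable def square (a b : ℤ) : Finset (ℤ × ℤ) := Finset.Icc a b ×ˢ Finset.Icc a b

/-- The points of residue `c` in the corner square. -/
noncomputable def cornerClass (c : ℤ) : Finset (ℤ × ℤ) := {p ∈ square 0 5 | residue p = c}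

/-- A replacement for `cornerClass c` that uses one point less and stays inside the grid. -/
def patch (c : ℤ) : Finset (ℤ × ℤ) :=
  if c = 0 then {(1, 1), (1, 4), (2, 2), (2, 4), (4, 1), (4, 3), (5, 5)}
  else if c = 1 then {(1, 2), (1, 5), (2, 2), (3, 4), (4, 1), (5, 3)}
  else if c = 2 then {(1, 1), (1, 3), (2, 5), (3, 2), (4, 4), (5, 1)}
  else if c = 3 then {(1, 3), (2, 1), (2, 3), (3, 5), (4, 2), (5, 4)}
  else {(1, 2), (1, 4), (3, 1), (3, 3), (4, 5), (5, 2)}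

theorem card_patch_lt : ∀ c ∈ Finset.Icc (0 : ℤ) 4, (patch c).card < (cornerClass c).card := by
  decide +kernel

theorem patch_subset : ∀ c ∈ Finset.Icc (0 : ℤ) 4, patch c ⊆ square 1 5 := by
  decide +kernel

theorem patch_dominates : ∀ c ∈ Finset.Icc (0 : ℤ) 4, ∀ s ∈ cornerClass c,
    ∀ v ∈ square 1 6, Near s v → ∃ u ∈ patch c, Near u v := by
  decide +kernel

theorem exists_near_residue (v : ℤ × ℤ) {r : ℤ} (hr : r ∈ Finset.Icc (0 : ℤ) 4) :
    ∃ s, Near s v ∧ residue s = r := by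
  obtain ⟨x, y⟩ := v
  rw [Finset.mem_Icc] at hr
  have h : (x + 2 * y) % 5 = r ∨ (x + 1 + 2 * y) % 5 = r ∨ (x - 1 + 2 * y) % 5 = r ∨
      (x + 2 * (y + 1)) % 5 = r ∨ (x + 2 * (y - 1)) % 5 = r := by omega
  rcases h with h | h | h | h | h
  · exact ⟨(x, y), by simp [Near], h⟩
  · exact ⟨(x + 1, y), by simp [Near], h⟩
  · exact ⟨(x - 1, y), by simp [Near], h⟩
  · exact ⟨(x, y + 1), by simp [Near], h⟩
  · exact ⟨(x, y - 1), by simp [Near], h⟩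

variable (M N : ℤ)

/-- The rotation taking the corner at the origin of the rectangle `[0, M] × [0, N]` to its
`i`-th corner. -/
def toCorner (i : Fin 4) (p : ℤ × ℤ) : ℤ × ℤ :=
  match i with
  | 0 => p
  | 1 => (M - p.2, p.1)
  | 2 => (M - p.1, N - p.2)
  | 3 => (p.2, N - p.1)

/-- The residue at the origin that `toCorner M N i` turns into the residue `r`. -/
def cornerResidue (r : ℤ) (i : Fin 4) : ℤ :=
  match i with
  | 0 => r % 5
  | 1 => (3 * (r - M)) % 5
  | 2 => (M + 2 * N - r) % 5
  | 3 => (3 * (2 * N - r)) % 5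

theorem cornerResidue_mem (r : ℤ) (i : Fin 4) :
    cornerResidue M N r i ∈ Finset.Icc (0 : ℤ) 4 := by
  rw [Finset.mem_Icc]
  fin_cases i <;> simp only [cornerResidue] <;> omega

theorem toCorner_injective (i : Fin 4) : Function.Injective (toCorner M N i) := by
  rintro ⟨a, b⟩ ⟨c, d⟩ h
  fin_cases i <;> simp only [toCorner, Prod.mk.injEq] at h ⊢ <;> omega

theorem toCorner_surjective (i : Fin 4) : Function.Surjective (toCorner M N i) := by
  rintro ⟨a, b⟩
  fin_cases i
  · exact ⟨(a, b), rfl⟩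
  · exact ⟨(b, M - a), by simp [toCorner]⟩
  · exact ⟨(M - a, N - b), by simp [toCorner]⟩
  · exact ⟨(N - b, a), by simp [toCorner]⟩

theorem near_toCorner (i : Fin 4) (p q : ℤ × ℤ) :
    Near (toCorner M N i p) (toCorner M N i q) ↔ Near p q := by
  fin_cases i <;> simp only [toCorner, Near] <;> omega

theorem residue_toCorner {r : ℤ} (hr : r ∈ Finset.Icc (0 : ℤ) 4) (i : Fin 4) (p : ℤ × ℤ) :
    residue (toCorner M N i p) = r ↔ residue p = cornerResidue M N r i := by
  rw [Finset.mem_Icc] at hr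
  fin_cases i <;> simp only [toCorner, residue, cornerResidue] <;> omega

/-- The rectangle `[0, M] × [0, N]`. -/
noncomputable def box : Finset (ℤ × ℤ) := Finset.Icc 0 M ×ˢ Finset.Icc 0 N

/-- The interior of `box M N`. -/
noncomputable def inner : Finset (ℤ × ℤ) := Finset.Icc 1 (M - 1) ×ˢ Finset.Icc 1 (N - 1)

/-- The points of residue `r` in the rectangle. -/
noncomputable def boxClass (r : ℤ) : Finset (ℤ × ℤ) := {p ∈ box M N | residue p = r}

/-- The points of residue `r` in the `i`-th corner square. -/
noncomputable def cornerPart (r : ℤ) (i : Fin 4) : Finset (ℤ × ℤ) :=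
  (cornerClass (cornerResidue M N r i)).image (toCorner M N i)

/-- The replacement for `cornerPart M N r i`. -/
noncomputable def cornerPatch (r : ℤ) (i : Fin 4) : Finset (ℤ × ℤ) :=
  (patch (cornerResidue M N r i)).image (toCorner M N i)

/-- Projection of the rectangle onto its interior. -/
def proj (p : ℤ × ℤ) : ℤ × ℤ := (max 1 (min p.1 (M - 1)), max 1 (min p.2 (N - 1)))

/-- A dominating set of `inner M N`. -/
noncomputable def dominatingSet (r : ℤ) : Finset (ℤ × ℤ) :=
  (boxClass M N r \ Finset.univ.biUnion (cornerPart M N r)).image (proj M N) ∪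
    Finset.univ.biUnion (cornerPatch M N r)

variable {M N}

theorem cornerPart_subset {r : ℤ} (hM : 11 ≤ M) (hN : 11 ≤ N) (hr : r ∈ Finset.Icc (0 : ℤ) 4)
    (i : Fin 4) : cornerPart M N r i ⊆ boxClass M N r := by
  intro q hq
  obtain ⟨p, hp, rfl⟩ := Finset.mem_image.1 hq
  obtain ⟨hp, hc⟩ := Finset.mem_filter.1 hp
  refine Finset.mem_filter.2 ⟨?_, (residue_toCorner M N hr i p).2 hc⟩
  simp only [square, box, Finset.mem_product, Finset.mem_Icc] at hp ⊢
  fin_cases i <;> simp only [toCorner] <;> omega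

theorem cornerPart_disjoint {r : ℤ} (hM : 11 ≤ M) (hN : 11 ≤ N) {i j : Fin 4} (hij : i ≠ j) :
    Disjoint (cornerPart M N r i) (cornerPart M N r j) := by
  rw [Finset.disjoint_left]
  intro q hi hj
  obtain ⟨p, hp, rfl⟩ := Finset.mem_image.1 hi
  obtain ⟨p', hp', h⟩ := Finset.mem_image.1 hj
  have hp := (Finset.mem_filter.1 hp).1
  have hp' := (Finset.mem_filter.1 hp').1
  simp only [square, Finset.mem_product, Finset.mem_Icc] at hp hp'
  fin_cases i <;> fin_cases j <;>
    first
    | exact hij rfl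
    | (simp only [toCorner, Prod.ext_iff] at h; omega)

theorem card_dominatingSet {r : ℤ} (hM : 11 ≤ M) (hN : 11 ≤ N)
    (hr : r ∈ Finset.Icc (0 : ℤ) 4) :
    (dominatingSet M N r).card + 4 ≤ (boxClass M N r).card := by
  have hsub : Finset.univ.biUnion (cornerPart M N r) ⊆ boxClass M N r :=
    Finset.biUnion_subset.2 fun i _ => cornerPart_subset hM hN hr i
  have hcorner : (Finset.univ.biUnion (cornerPart M N r)).card =
      ∑ i, (cornerPart M N r i).card :=
    Finset.card_biUnion fun i _ j _ hij => cornerPart_disjoint hM hN hij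
  have hlt (i : Fin 4) : (cornerPatch M N r i).card + 1 ≤ (cornerPart M N r i).card := by
    rw [cornerPatch, cornerPart, Finset.card_image_of_injective _ (toCorner_injective M N i),
      Finset.card_image_of_injective _ (toCorner_injective M N i)]
    exact card_patch_lt _ (cornerResidue_mem M N r i)
  have hsum : ∑ i, (cornerPatch M N r i).card + 4 ≤ ∑ i, (cornerPart M N r i).card := by
    simpa [Finset.sum_add_distrib] using Finset.sum_le_sum fun i (_ : i ∈ Finset.univ) => hlt i
  have hpatch : (Finset.univ.biUnion (cornerPatch M N r)).card ≤
      ∑ i, (cornerPatch M N r i).card := Finset.card_biUnion_le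
  have hproj := Finset.card_image_le (f := proj M N)
    (s := boxClass M N r \ Finset.univ.biUnion (cornerPart M N r))
  have hunion := Finset.card_union_le
    ((boxClass M N r \ Finset.univ.biUnion (cornerPart M N r)).image (proj M N))
    (Finset.univ.biUnion (cornerPatch M N r))
  have hsdiff := Finset.card_sdiff_add_card_eq_card hsub
  rw [dominatingSet]
  omega

theorem dominatingSet_dominates {r : ℤ} (hM : 11 ≤ M) (hN : 11 ≤ N)
    (hr : r ∈ Finset.Icc (0 : ℤ) 4) {v : ℤ × ℤ} (hv : v ∈ inner M N) :
    ∃ u ∈ dominatingSet M N r, u ∈ inner M N ∧ Near u v := by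
  obtain ⟨s, hs, hsr⟩ := exists_near_residue v hr
  by_cases hcorner : s ∈ Finset.univ.biUnion (cornerPart M N r)
  · obtain ⟨i, -, hi⟩ := Finset.mem_biUnion.1 hcorner
    obtain ⟨s, hsc, rfl⟩ := Finset.mem_image.1 hi
    obtain ⟨v, rfl⟩ := toCorner_surjective M N i v
    rw [near_toCorner] at hs
    have hv' : v ∈ square 1 6 := by
      have hsq := (Finset.mem_filter.1 hsc).1
      simp only [square, inner, Finset.mem_product, Finset.mem_Icc] at hsq hv ⊢
      unfold Near at hs
      fin_cases i <;> simp only [toCorner] at hv <;> omega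
    have hc := cornerResidue_mem M N r i
    obtain ⟨u, hu, huv⟩ := patch_dominates _ hc s hsc v hv' hs
    refine ⟨toCorner M N i u, Finset.mem_union_right _ (Finset.mem_biUnion.2
      ⟨i, Finset.mem_univ i, Finset.mem_image_of_mem _ hu⟩), ?_, (near_toCorner M N i u v).2 huv⟩
    have hsq := patch_subset _ hc hu
    simp only [square, inner, Finset.mem_product, Finset.mem_Icc] at hsq ⊢
    fin_cases i <;> simp only [toCorner] <;> omega
  · simp only [inner, Finset.mem_product, Finset.mem_Icc] at hv
    have hbox : s ∈ box M N := by
      simp only [box, Finset.mem_product, Finset.mem_Icc]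
      unfold Near at hs
      omega
    refine ⟨proj M N s, Finset.mem_union_left _ (Finset.mem_image_of_mem _
      (Finset.mem_sdiff.2 ⟨Finset.mem_filter.2 ⟨hbox, hsr⟩, hcorner⟩)), ?_, ?_⟩
    · simp only [proj, inner, Finset.mem_product, Finset.mem_Icc]
      omega
    · unfold Near at hs
      simp only [proj, Near]
      omega

theorem exists_card_boxClass_le (m n : ℕ) :
    ∃ r ∈ Finset.Icc (0 : ℤ) 4,
      (boxClass (m + 1) (n + 1) r).card ≤ (m + 2) * (n + 2) / 5 := by
  have hcard : (box (m + 1) (n + 1)).card = (m + 2) * (n + 2) := by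
    simp only [box, Finset.card_product, Int.card_Icc]
    congr 1
  have hmaps : ∀ p ∈ box (m + 1) (n + 1), residue p ∈ Finset.Icc (0 : ℤ) 4 := by
    intro p _
    rw [residue, Finset.mem_Icc]
    omega
  have hlt : (box (m + 1) (n + 1)).card <
      (Finset.Icc (0 : ℤ) 4).card * ((m + 2) * (n + 2) / 5 + 1) := by
    rw [hcard, show (Finset.Icc (0 : ℤ) 4).card = 5 from by simp]
    omega
  obtain ⟨r, hr, h⟩ := Finset.exists_card_fiber_lt_of_card_lt_mul hlt
  exact ⟨r, hr, Nat.lt_succ_iff.1 h⟩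

/-- The point of `ℤ × ℤ` corresponding to a vertex of the grid graph. -/
def toPoint {m n : ℕ} (v : Fin m × Fin n) : ℤ × ℤ := ((v.1 : ℕ) + 1, (v.2 : ℕ) + 1)

theorem toPoint_injective {m n : ℕ} : Function.Injective (toPoint (m := m) (n := n)) := by
  rintro ⟨a, b⟩ ⟨c, d⟩ h
  simp only [toPoint, Prod.mk.injEq, Fin.ext_iff] at h ⊢
  omega

theorem toPoint_mem_inner {m n : ℕ} (v : Fin m × Fin n) :
    toPoint v ∈ inner (m + 1) (n + 1) := by
  have h₁ := v.1.isLt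
  have h₂ := v.2.isLt
  simp only [toPoint, inner, Finset.mem_product, Finset.mem_Icc]
  omega

theorem exists_toPoint_eq {m n : ℕ} {p : ℤ × ℤ} (hp : p ∈ inner (m + 1) (n + 1)) :
    ∃ v : Fin m × Fin n, toPoint v = p := by
  simp only [inner, Finset.mem_product, Finset.mem_Icc] at hp
  refine ⟨(⟨(p.1 - 1).toNat, by omega⟩, ⟨(p.2 - 1).toNat, by omega⟩), ?_⟩
  simp only [toPoint, Prod.ext_iff]
  omega

theorem adj_of_near {m n : ℕ} {u v : Fin m × Fin n} (huv : u ≠ v)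
    (h : Near (toPoint u) (toPoint v)) : (gridGraph m n).Adj u v := by
  refine (SimpleGraph.fromRel_adj _ _ _).2 ⟨huv, ?_⟩
  rw [Ne, Prod.ext_iff, Fin.ext_iff, Fin.ext_iff] at huv
  simp only [Near, toPoint] at h
  simp only [Fin.ext_iff]
  omega

end GridDomination

open GridDomination in
theorem grid_domination_number_le (m n : ℕ) (hm : 16 ≤ m) (hn : 16 ≤ n) :
    dominationNumber (gridGraph m n) ≤ (m + 2) * (n + 2) / 5 - 4 := by
  obtain ⟨r, hr, hcard⟩ := exists_card_boxClass_le m n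
  have hM : (11 : ℤ) ≤ m + 1 := by omega
  have hN : (11 : ℤ) ≤ n + 1 := by omega
  have hle := card_dominatingSet hM hN hr
  have hD : IsDominatingSet (gridGraph m n)
      ↑({v | toPoint v ∈ dominatingSet (m + 1) (n + 1) r} : Finset (Fin m × Fin n)) := by
    intro v hv
    obtain ⟨p, hp, hpi, hpv⟩ := dominatingSet_dominates hM hN hr (toPoint_mem_inner v)
    obtain ⟨u, rfl⟩ := exists_toPoint_eq hpi
    have hu : u ∈ (↑({v | toPoint v ∈ dominatingSet (m + 1) (n + 1) r} :
        Finset (Fin m × Fin n)) : Set (Fin m × Fin n)) := by simpa using hp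
    exact ⟨u, hu, adj_of_near (fun h => hv (h ▸ hu)) hpv⟩
  have hDcard : ({v | toPoint v ∈ dominatingSet (m + 1) (n + 1) r} :
      Finset (Fin m × Fin n)).card ≤ (dominatingSet (m + 1) (n + 1) r).card :=
    Finset.card_le_card_of_injOn toPoint (fun v hv => by simpa using hv)
      toPoint_injective.injOn
  have hmin : dominationNumber (gridGraph m n) ≤ _ := Nat.sInf_le ⟨_, hD, rfl⟩
  omega
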